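/- Let Λ = {A n : n ∈ ℤ³} be a Bravais lattice in ℝ³ (the uniformly deformed atomic lattice) with A an invertible real 3×3 matrix and per-atom volume Ω = |det A|. Let g : ℝ³ → ℝ³ be a compactly supported pair-force law with g(−y) = −g(y) for all y (so f_ij = g(x_i − x_j) gives antisymmetric pairwise forces depending only on relative positions), and define the virial stress σ = −(1/(2Ω)) Σ_{y∈Λ, y≠0} g(y) yᵀ ∈ ℝ^{3×3}. Let φ₀ : ℝ³ → ℝ be a twice continuously differentiable kernel (compactly supported, φ₀(−x) = φ₀(x)) with ∫_{ℝ³} φ₀ = 1, and for R ≥ 1 let φ_R(x) = R^{−3} φ₀(x/R). Define the Hardy stress σ̃_R(x) = −(1/2) Σ_{p∈Λ} Σ_{q∈Λ, q≠p} g(p−q) (p−q)ᵀ ∫₀¹ φ_R(x − p + λ(p−q)) dλ (for each x this is a finite sum). Then there exists a constant C, depending only on g, φ₀ and A, such that for every R ≥ 1 satisfying the first moment condition Σ_{y∈Λ} φ_R(y) = 1/Ω, and every lattice point x₀ ∈ Λ: ‖σ̃_R(x₀) − σ‖ ≤ C R^{−2}. -/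

import Mathlib

open scoped BigOperators

/-- The Bravais lattice generated by an (invertible) matrix `A`. -/
def bravaisLattice (A : Matrix (Fin 3) (Fin 3) ℝ) : Set (Fin 3 → ℝ) :=
  {x | ∃ n : Fin 3 → ℤ, x = A.mulVec (fun k => (n k : ℝ))}

theorem bravaisLattice.neg_mem {A : Matrix (Fin 3) (Fin 3) ℝ} {x : Fin 3 → ℝ}
    (hx : x ∈ bravaisLattice A) : -x ∈ bravaisLattice A := by
  obtain ⟨n, rfl⟩ := hx
  refine ⟨-n, ?_⟩
  rw [← Matrix.mulVec_neg]
  congr 1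
  ext k
  simp

theorem bravaisLattice.sub_mem {A : Matrix (Fin 3) (Fin 3) ℝ} {x y : Fin 3 → ℝ}
    (hx : x ∈ bravaisLattice A) (hy : y ∈ bravaisLattice A) : x - y ∈ bravaisLattice A := by
  obtain ⟨n, rfl⟩ := hx
  obtain ⟨m, rfl⟩ := hy
  refine ⟨n - m, ?_⟩
  rw [← Matrix.mulVec_sub]
  congr 1
  ext k
  simp

/-- The number of points of a Bravais lattice in a ball grows at most cubically. -/
theorem bravaisLattice.exists_ncard_inter_closedBall_le {A : Matrix (Fin 3) (Fin 3) ℝ}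
    (hA : IsUnit A.det) :
    ∃ K : ℝ, 0 ≤ K ∧ ∀ r : ℝ, 0 ≤ r →
      (bravaisLattice A ∩ Metric.closedBall 0 r).Finite ∧
      ((bravaisLattice A ∩ Metric.closedBall 0 r).ncard : ℝ) ≤ (2 * (K * r) + 1) ^ 3 := by
  set K : ℝ := ∑ i, ∑ j, |A⁻¹ i j| with hK
  have hK0 : 0 ≤ K := by positivity
  refine ⟨K, hK0, fun r hr => ?_⟩
  set N : ℕ := ⌊K * r⌋₊
  let box : Finset (Fin 3 → ℤ) := Fintype.piFinset fun _ => Finset.Icc (-(N : ℤ)) N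
  let pts : Finset (Fin 3 → ℝ) := box.image fun n => A.mulVec fun k => (n k : ℝ)
  have hsub : bravaisLattice A ∩ Metric.closedBall 0 r ⊆ pts := by
    rintro x ⟨⟨n, hn⟩, hx⟩
    rw [mem_closedBall_zero_iff] at hx
    refine Finset.mem_coe.2 (Finset.mem_image.2 ⟨n, Fintype.mem_piFinset.2 fun i => ?_, hn.symm⟩)
    have h1 : (fun k => (n k : ℝ)) = A⁻¹.mulVec x := by
      rw [hn, Matrix.mulVec_mulVec, Matrix.nonsing_inv_mul A hA, Matrix.one_mulVec]
    have h2 : |(n i : ℝ)| ≤ K * r := by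
      rw [congrFun h1 i, Matrix.mulVec, dotProduct]
      calc |∑ j, A⁻¹ i j * x j| ≤ ∑ j, |A⁻¹ i j * x j| := Finset.abs_sum_le_sum_abs _ _
        _ ≤ ∑ j, |A⁻¹ i j| * r := by
          refine Finset.sum_le_sum fun j _ => ?_
          rw [abs_mul]
          gcongr
          exact (norm_le_pi_norm x j).trans hx
        _ = (∑ j, |A⁻¹ i j|) * r := by rw [Finset.sum_mul]
        _ ≤ K * r := by
          gcongr
          exact Finset.single_le_sum (f := fun i => ∑ j, |A⁻¹ i j|)
            (fun _ _ => by positivity) (Finset.mem_univ i)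
    have h3 : (n i).natAbs ≤ N := by
      refine Nat.le_floor ?_
      rwa [Nat.cast_natAbs, Int.cast_abs]
    rw [Finset.mem_Icc]
    omega
  refine ⟨pts.finite_toSet.subset hsub, ?_⟩
  have hcard : (bravaisLattice A ∩ Metric.closedBall 0 r).ncard ≤ (2 * N + 1) ^ 3 := by
    calc _ ≤ (pts : Set (Fin 3 → ℝ)).ncard := Set.ncard_le_ncard hsub pts.finite_toSet
      _ = pts.card := Set.ncard_coe_finset _
      _ ≤ box.card := Finset.card_image_le
      _ = (2 * N + 1) ^ 3 := by
        rw [Fintype.card_piFinset_const, Int.card_Icc]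
        congr 1
        omega
  have hN : (N : ℝ) ≤ K * r := Nat.floor_le (by positivity)
  calc _ ≤ (((2 * N + 1) ^ 3 : ℕ) : ℝ) := by exact_mod_cast hcard
    _ = (2 * (N : ℝ) + 1) ^ 3 := by push_cast; ring
    _ ≤ _ := by gcongr

/-- Second differences of a compactly supported `C²` function are of second order. -/
theorem ContDiff.exists_abs_second_difference_le {E : Type*} [NormedAddCommGroup E]
    [NormedSpace ℝ E] {f : E → ℝ} (hf : ContDiff ℝ 2 f) (hc : HasCompactSupport f) :
    ∃ M : ℝ, 0 ≤ M ∧ ∀ x u : E, |f (x + u) + f (x - u) - 2 * f x| ≤ M * ‖u‖ ^ 2 := by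
  have hd : ContDiff ℝ 1 (fderiv ℝ f) := hf.fderiv_right (by norm_num)
  obtain ⟨M, hM⟩ := hd.lipschitzWith_of_hasCompactSupport (hc.fderiv ℝ) one_ne_zero
  have hdiff : Differentiable ℝ f := hf.differentiable (by norm_num)
  refine ⟨M, M.2, fun x u => ?_⟩
  have key := (convex_univ (𝕜 := ℝ) (E := E)).norm_image_sub_le_of_norm_hasFDerivWithin_le
    (f := fun w => f (w + u) - f w) (f' := fun w => fderiv ℝ f (w + u) - fderiv ℝ f w)
    (C := M * ‖u‖) (x := x - u) (y := x)
    (fun w _ => (((hasFDerivAt_comp_add_right u).2 (hdiff (w + u)).hasFDerivAt).sub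
      (hdiff w).hasFDerivAt).hasFDerivWithinAt)
    (fun w _ => by simpa using hM.norm_sub_le (w + u) w) (Set.mem_univ _) (Set.mem_univ _)
  rw [Real.norm_eq_abs] at key
  simp only [sub_add_cancel, sub_sub_cancel] at key
  calc _ = |f (x + u) - f x - (f x - f (x - u))| := by ring_nf
    _ ≤ M * ‖u‖ * ‖u‖ := key
    _ = _ := by ring

/-- Summing an even function over a symmetric finite set, a shift costs only second differences. -/
theorem abs_sum_add_sub_sum_le {E : Type*} [AddCommGroup E] {f : E → ℝ}
    (hf : ∀ x, f (-x) = f x) {Z : Finset E} (hZ : ∀ z ∈ Z, -z ∈ Z) {s : E} {B : ℝ}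
    (hB : ∀ z, |f (z + s) + f (z - s) - 2 * f z| ≤ B) :
    |∑ z ∈ Z, f (z + s) - ∑ z ∈ Z, f z| ≤ Z.card * B / 2 := by
  have hsym : ∑ z ∈ Z, f (z - s) = ∑ z ∈ Z, f (z + s) := by
    refine Finset.sum_nbij' (fun z => -z) (fun z => -z) hZ hZ (by simp) (by simp) fun z _ => ?_
    rw [← hf]
    congr 1
    abel
  have h : 2 * (∑ z ∈ Z, f (z + s) - ∑ z ∈ Z, f z)
      = ∑ z ∈ Z, (f (z + s) + f (z - s) - 2 * f z) := by
    rw [Finset.sum_sub_distrib, Finset.sum_add_distrib, hsym, ← Finset.mul_sum]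
    ring
  have h2 : |2 * (∑ z ∈ Z, f (z + s) - ∑ z ∈ Z, f z)| ≤ Z.card * B := by
    rw [h, ← nsmul_eq_mul]
    exact (Finset.abs_sum_le_sum_abs _ _).trans (Finset.sum_le_card_nsmul _ _ _ fun z _ => hB z)
  rw [abs_mul, abs_two] at h2
  linarith

/-- The double lattice sum of a function of `p` and `p - q` as a finite double sum. -/
theorem bravaisLattice.finsum_pair_eq_sum {A : Matrix (Fin 3) (Fin 3) ℝ} {M : Type*}
    [AddCommMonoid M] (F : (Fin 3 → ℝ) → (Fin 3 → ℝ) → M) {x₀ : Fin 3 → ℝ}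
    (hx₀ : x₀ ∈ bravaisLattice A) {S Z : Finset (Fin 3 → ℝ)}
    (hS : ↑S ⊆ bravaisLattice A \ {0}) (hZ : ↑Z ⊆ bravaisLattice A)
    (hFS : ∀ p, ∀ y ∈ bravaisLattice A \ {0}, y ∉ S → F p y = 0)
    (hFZ : ∀ z ∈ bravaisLattice A, z ∉ Z → ∀ y ∈ S, F (x₀ - z) y = 0) :
    ∑ᶠ p ∈ bravaisLattice A, ∑ᶠ q ∈ bravaisLattice A \ {p}, F p (p - q)
      = ∑ z ∈ Z, ∑ y ∈ S, F (x₀ - z) y := by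
  have inner : ∀ p ∈ bravaisLattice A,
      ∑ᶠ q ∈ bravaisLattice A \ {p}, F p (p - q) = ∑ y ∈ S, F p y := by
    intro p hp
    have hbij : Set.BijOn (fun q => p - q) (bravaisLattice A \ {p}) (bravaisLattice A \ {0}) := by
      refine ⟨fun q hq => ⟨sub_mem hp hq.1, fun h => hq.2 (sub_eq_zero.1 h).symm⟩,
        sub_right_injective.injOn, fun y hy => ⟨p - y, ⟨sub_mem hp hy.1, fun h => hy.2 ?_⟩, ?_⟩⟩
      · simpa using h
      · simp
    rw [finsum_mem_eq_of_bijOn (fun q => p - q) hbij (g := F p) fun _ _ => rfl]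
    refine finsum_mem_eq_sum_of_inter_support_eq _ ?_
    ext y
    refine ⟨fun h => ⟨?_, h.2⟩, fun h => ⟨hS h.1, h.2⟩⟩
    by_contra hy
    exact h.2 (hFS p y h.1 hy)
  rw [finsum_mem_congr rfl inner]
  have hbij : Set.BijOn (fun p => x₀ - p) (bravaisLattice A) (bravaisLattice A) :=
    ⟨fun p hp => sub_mem hx₀ hp, sub_right_injective.injOn,
      fun z hz => ⟨x₀ - z, sub_mem hx₀ hz, by simp⟩⟩
  rw [finsum_mem_eq_of_bijOn (fun p => x₀ - p) hbij
    (g := fun z => ∑ y ∈ S, F (x₀ - z) y) fun p _ => by simp]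
  refine finsum_mem_eq_sum_of_inter_support_eq _ ?_
  ext z
  refine ⟨fun h => ⟨?_, h.2⟩, fun h => ⟨hZ h.1, h.2⟩⟩
  by_contra hz
  exact h.2 (Finset.sum_eq_zero (hFZ z h.1 hz))

/-- A compactly supported function vanishes outside some ball around the origin. -/
theorem HasCompactSupport.exists_eq_zero_of_lt_norm {E F : Type*} [NormedAddCommGroup E] [Zero F]
    {f : E → F} (hf : HasCompactSupport f) : ∃ ρ : ℝ, 0 ≤ ρ ∧ ∀ x, ρ < ‖x‖ → f x = 0 := by
  obtain ⟨ρ, hρ⟩ := hf.isBounded.subset_closedBall (0 : E)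
  refine ⟨max ρ 0, le_max_right _ _, fun x hx => ?_⟩
  refine image_eq_zero_of_notMem_tsupport fun h => ?_
  have := mem_closedBall_zero_iff.1 (hρ h)
  exact absurd (this.trans (le_max_left _ _)) (not_le.2 hx)

/-- Let `Λ` be a (uniformly deformed) Bravais lattice with per-atom
volume `Ω = |det A|`, `g` a compactly supported odd pair-force law, and
`σ = −(1/(2Ω)) Σ_{y∈Λ, y≠0} g(y) yᵀ` the virial stress. Let `φ₀` be a `C²` compactly
supported even kernel with `∫ φ₀ = 1`, and `φ_R(x) = R⁻³ φ₀(x/R)`. Then there is a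
constant `C` (depending only on `g`, `φ₀`, `A`) such that for every `R ≥ 1` satisfying
the first moment condition `Σ_{y∈Λ} φ_R(y) = 1/Ω` and every lattice point `x₀ ∈ Λ`, the
Hardy stress `σ̃_R(x₀)` satisfies `‖σ̃_R(x₀) − σ‖ ≤ C R⁻²` (entrywise). -/
theorem hardy_stress_second_order_accuracy
    (A : Matrix (Fin 3) (Fin 3) ℝ) (hA : IsUnit A.det)
    (g : (Fin 3 → ℝ) → (Fin 3 → ℝ)) (hgc : HasCompactSupport g)
    (hgodd : ∀ y : Fin 3 → ℝ, g (-y) = - g y)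
    (φ₀ : (Fin 3 → ℝ) → ℝ) (hφ : ContDiff ℝ 2 φ₀) (hc : HasCompactSupport φ₀)
    (hsymm : ∀ x : Fin 3 → ℝ, φ₀ (-x) = φ₀ x)
    (hint : (∫ x : Fin 3 → ℝ, φ₀ x) = 1)
    (σ : Matrix (Fin 3) (Fin 3) ℝ)
    (hσ : σ = -(1 / (2 * |A.det|)) •
        ∑ᶠ y ∈ bravaisLattice A \ {0}, Matrix.vecMulVec (g y) y) :
    ∃ C : ℝ, ∀ R : ℝ, 1 ≤ R →
      (∑ᶠ y ∈ bravaisLattice A, (R ^ 3)⁻¹ * φ₀ (R⁻¹ • y)) = 1 / |A.det| →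
      ∀ x₀ ∈ bravaisLattice A, ∀ α β : Fin 3,
        |(-(1/2 : ℝ) • ∑ᶠ p ∈ bravaisLattice A, ∑ᶠ q ∈ bravaisLattice A \ {p},
              (∫ l in (0:ℝ)..1, (R ^ 3)⁻¹ * φ₀ (R⁻¹ • (x₀ - p + l • (p - q)))) •
                Matrix.vecMulVec (g (p - q)) (p - q)) α β
          - σ α β|
          ≤ C / R ^ 2 := by
  obtain ⟨K, hK0, hK⟩ := bravaisLattice.exists_ncard_inter_closedBall_le hA
  obtain ⟨M, hM0, hM⟩ := hφ.exists_abs_second_difference_le hc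
  obtain ⟨ρ, hρ0, hρ⟩ := hc.exists_eq_zero_of_lt_norm
  obtain ⟨γ, hγ0, hγ⟩ := hgc.exists_eq_zero_of_lt_norm
  have hSfin : ((bravaisLattice A ∩ Metric.closedBall 0 γ) \ {0}).Finite :=
    (hK γ hγ0).1.subset Set.sdiff_subset
  set S : Finset (Fin 3 → ℝ) := hSfin.toFinset
  have memS : ∀ y, y ∈ S ↔ (y ∈ bravaisLattice A ∧ ‖y‖ ≤ γ) ∧ y ≠ 0 := fun y => by
    simp [S]
  have hSsub : ↑S ⊆ bravaisLattice A \ {0} := fun y hy =>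
    ⟨((memS y).1 hy).1.1, ((memS y).1 hy).2⟩
  have hSg : ∀ y ∈ bravaisLattice A \ {0}, y ∉ S → g y = 0 := fun y hy hyS =>
    hγ y (not_le.1 fun h => hyS ((memS y).2 ⟨⟨hy.1, h⟩, hy.2⟩))
  have hσS : σ = -(1 / (2 * |A.det|)) • ∑ y ∈ S, Matrix.vecMulVec (g y) y := by
    rw [hσ]
    congr 1
    refine finsum_mem_eq_sum_of_inter_support_eq _ ?_
    ext y
    refine ⟨fun h => ⟨?_, h.2⟩, fun h => ⟨hSsub h.1, h.2⟩⟩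
    by_contra hy
    exact h.2 (by simp [hSg y h.1 hy])
  set T : ℝ := ρ + γ
  set D : ℝ := (2 * (K * T) + 1) ^ 3 * (M * γ ^ 2) / 2
  refine ⟨1 / 2 * ∑ y ∈ S, ‖g y‖ * ‖y‖ * D, fun R hR hmom x₀ hx₀ α β => ?_⟩
  have hR0 : 0 < R := by linarith
  have hZ := hK (R * T) (by positivity)
  set Z : Finset (Fin 3 → ℝ) := hZ.1.toFinset
  have memZ : ∀ z, z ∈ Z ↔ z ∈ bravaisLattice A ∧ ‖z‖ ≤ R * T := fun z => by
    simp [Z]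
  have hZsub : ↑Z ⊆ bravaisLattice A := fun z hz => ((memZ z).1 hz).1
  have hZneg : ∀ z ∈ Z, -z ∈ Z := fun z hz => by
    rw [memZ] at hz ⊢
    exact ⟨bravaisLattice.neg_mem hz.1, by simpa using hz.2⟩
  have hZcard : (Z.card : ℝ) ≤ ((2 * (K * T) + 1) * R) ^ 3 := by
    rw [← Set.ncard_eq_toFinset_card _ hZ.1]
    refine hZ.2.trans (pow_le_pow_left₀ (by positivity) ?_ 3)
    nlinarith
  set φR : (Fin 3 → ℝ) → ℝ := fun x => (R ^ 3)⁻¹ * φ₀ (R⁻¹ • x) with hφR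
  have hφRcont : Continuous φR := by
    have := hφ.continuous
    fun_prop
  have hφReven : ∀ x, φR (-x) = φR x := fun x => by simp [hφR, hsymm]
  have hfar : ∀ z ∈ bravaisLattice A, z ∉ Z → ∀ s : Fin 3 → ℝ, ‖s‖ ≤ γ → φR (z + s) = 0 := by
    intro z hz hzZ s hs
    have hz' : R * T < ‖z‖ := not_le.1 fun h => hzZ ((memZ z).2 ⟨hz, h⟩)
    have h1 : R * ρ < ‖z + s‖ := by
      have h2 : ‖z‖ ≤ ‖z + s‖ + ‖s‖ := by simpa using norm_sub_le (z + s) s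
      have h3 : R * T = R * ρ + R * γ := mul_add _ _ _
      nlinarith
    have h4 : φ₀ (R⁻¹ • (z + s)) = 0 := by
      refine hρ _ ?_
      rw [norm_smul, Real.norm_of_nonneg (by positivity), inv_mul_eq_div, lt_div_iff₀ hR0]
      linarith
    simp only [hφR, h4, mul_zero]
  have hmomZ : ∑ z ∈ Z, φR z = 1 / |A.det| := by
    rw [← hmom]
    symm
    refine finsum_mem_eq_sum_of_inter_support_eq _ ?_
    ext z
    refine ⟨fun h => ⟨?_, h.2⟩, fun h => ⟨hZsub h.1, h.2⟩⟩
    by_contra hz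
    have h0 := hfar z h.1 hz 0 (by simpa using hγ0)
    rw [add_zero] at h0
    exact h.2 h0
  have hshift : ∀ s : Fin 3 → ℝ, ‖s‖ ≤ γ →
      |∑ z ∈ Z, φR (z + s) - (1 / |A.det|)| ≤ D / R ^ 2 := by
    intro s hs
    have hB : ∀ z, |φR (z + s) + φR (z - s) - 2 * φR z| ≤ (R ^ 3)⁻¹ * (M * (γ ^ 2 / R ^ 2)) := by
      intro z
      have h1 : φR (z + s) + φR (z - s) - 2 * φR z = (R ^ 3)⁻¹ *
          (φ₀ (R⁻¹ • z + R⁻¹ • s) + φ₀ (R⁻¹ • z - R⁻¹ • s) - 2 * φ₀ (R⁻¹ • z)) := by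
        simp only [hφR, smul_add, smul_sub]
        ring
      rw [h1, abs_mul, abs_of_pos (by positivity : 0 < (R ^ 3)⁻¹)]
      gcongr
      refine (hM _ _).trans ?_
      rw [norm_smul, Real.norm_of_nonneg (by positivity), inv_mul_eq_div, div_pow]
      gcongr
    rw [← hmomZ]
    refine (abs_sum_add_sub_sum_le hφReven hZneg hB).trans ?_
    calc (Z.card : ℝ) * ((R ^ 3)⁻¹ * (M * (γ ^ 2 / R ^ 2))) / 2
        ≤ ((2 * (K * T) + 1) * R) ^ 3 * ((R ^ 3)⁻¹ * (M * (γ ^ 2 / R ^ 2))) / 2 := by gcongr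
      _ = D / R ^ 2 := by
        simp only [D]
        field_simp
  have hbond : ∀ y ∈ S,
      |∑ z ∈ Z, (∫ l in (0:ℝ)..1, φR (z + l • y)) - (1 / |A.det|)| ≤ D / R ^ 2 := by
    intro y hy
    have hcont : ∀ z, Continuous fun l : ℝ => φR (z + l • y) := fun z => by fun_prop
    have h1 : ∑ z ∈ Z, (∫ l in (0:ℝ)..1, φR (z + l • y)) - 1 / |A.det|
        = ∫ l in (0:ℝ)..1, (∑ z ∈ Z, φR (z + l • y) - 1 / |A.det|) := by
      rw [intervalIntegral.integral_sub
        ((continuous_finsetSum _ fun z _ => hcont z).intervalIntegrable _ _) (by simp),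
        intervalIntegral.integral_finsetSum fun z _ => (hcont z).intervalIntegrable _ _]
      simp
    rw [h1]
    have h2 : D / R ^ 2 = D / R ^ 2 * |(1 : ℝ) - 0| := by rw [sub_zero, abs_one, mul_one]
    rw [h2, ← Real.norm_eq_abs]
    refine intervalIntegral.norm_integral_le_of_norm_le_const fun l hl => ?_
    rw [Set.uIoc_of_le zero_le_one] at hl
    refine hshift _ ?_
    rw [norm_smul, Real.norm_of_nonneg hl.1.le]
    have := ((memS y).1 hy).1.2
    nlinarith [hl.1, hl.2, norm_nonneg y]
  have hpair := bravaisLattice.finsum_pair_eq_sum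
    (fun p y => (∫ l in (0:ℝ)..1, φR (x₀ - p + l • y)) • Matrix.vecMulVec (g y) y)
    hx₀ hSsub hZsub (fun p y hy hyS => by simp [hSg y hy hyS]) (fun z hz hzZ y hy => by
      have h0 : (∫ l in (0:ℝ)..1, φR (z + l • y)) = ∫ l in (0:ℝ)..1, (0 : ℝ) := by
        refine intervalIntegral.integral_congr fun l hl => hfar z hz hzZ _ ?_
        rw [Set.uIcc_of_le zero_le_one] at hl
        rw [norm_smul, Real.norm_of_nonneg hl.1]
        have := ((memS y).1 hy).1.2
        nlinarith [hl.1, hl.2, norm_nonneg y]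
      simp only [sub_sub_cancel, h0, intervalIntegral.integral_zero, zero_smul])
  simp only [sub_sub_cancel] at hpair
  have hdiff : (-(1/2 : ℝ) • ∑ z ∈ Z, ∑ y ∈ S,
        (∫ l in (0:ℝ)..1, φR (z + l • y)) • Matrix.vecMulVec (g y) y) α β - σ α β
      = -(1 / 2) * ∑ y ∈ S, g y α * y β *
          (∑ z ∈ Z, (∫ l in (0:ℝ)..1, φR (z + l • y)) - 1 / |A.det|) := by
    rw [Finset.sum_comm, hσS]
    simp only [Matrix.smul_apply, Matrix.sum_apply, Matrix.vecMulVec_apply, smul_eq_mul,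
      mul_sub, Finset.sum_sub_distrib, ← Finset.sum_mul]
    simp only [mul_comm (∑ z ∈ Z, _) (_ * _)]
    ring
  have hfinal : |-(1 / 2) * ∑ y ∈ S, g y α * y β *
      (∑ z ∈ Z, (∫ l in (0:ℝ)..1, φR (z + l • y)) - 1 / |A.det|)|
      ≤ (1 / 2 * ∑ y ∈ S, ‖g y‖ * ‖y‖ * D) / R ^ 2 := by
    rw [abs_mul, abs_neg, abs_of_pos (by norm_num : (0 : ℝ) < 1 / 2), mul_div_assoc,
      Finset.sum_div]
    gcongr
    refine (Finset.abs_sum_le_sum_abs _ _).trans (Finset.sum_le_sum fun y hy => ?_)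
    rw [abs_mul, abs_mul, mul_div_assoc]
    gcongr
    · exact norm_le_pi_norm (g y) α
    · exact norm_le_pi_norm y β
    · exact hbond y hy
  rw [← hdiff, ← hpair] at hfinal
  exact hfinal
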